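/- Gaussian prior mass lower bound via the noncentral chi-squared density: if θ ~ N(0, I_d) in ℝ^d and θ* ∈ ℝ^d with λ = ‖θ*‖₂², then for every r > 0, P(‖θ − θ*‖₂ ≤ r) ≥ (e^{−λ/2}/Γ(d/2))·γ(d/2, r²/2), where γ is the lower incomplete gamma function. -/

import Mathlib

open MeasureTheory

/-- The lower incomplete gamma function `γ(α, r) = ∫₀^r w^{α−1} e^{−w} dw`. -/
noncomputable def lowerIncGamma (α r : ℝ) : ℝ :=
  ∫ w in Set.Ioc (0 : ℝ) r, w ^ (α - 1) * Real.exp (-w)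

open ProbabilityTheory Module Metric
open scoped RealInnerProductSpace

/-- The Lebesgue density of the standard Gaussian measure in dimension `n`,
as a function of the norm. -/
noncomputable def stdGaussianDensity (n : ℕ) (t : ℝ) : ℝ :=
  (2 * Real.pi) ^ (-(n / 2 : ℝ)) * Real.exp (-t ^ 2 / 2)

lemma stdGaussianDensity_pos (n : ℕ) (t : ℝ) : 0 < stdGaussianDensity n t := by
  unfold stdGaussianDensity; positivity

@[fun_prop]
lemma continuous_stdGaussianDensity (n : ℕ) : Continuous (stdGaussianDensity n) := by
  unfold stdGaussianDensity; fun_prop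

lemma stdGaussianDensity_parallelogram {E : Type*} [NormedAddCommGroup E]
    [InnerProductSpace ℝ E] (n : ℕ) (a x : E) :
    2 * (Real.exp (-‖a‖ ^ 2 / 2) * stdGaussianDensity n ‖x‖) ≤
      stdGaussianDensity n ‖a + x‖ + stdGaussianDensity n ‖a - x‖ := by
  have hp := parallelogram_law_with_norm ℝ a x
  set u := -‖a + x‖ ^ 2 / 4
  set v := -‖a - x‖ ^ 2 / 4
  have h : 2 * (Real.exp (-‖a‖ ^ 2 / 2) * Real.exp (-‖x‖ ^ 2 / 2)) ≤
      Real.exp (-‖a + x‖ ^ 2 / 2) + Real.exp (-‖a - x‖ ^ 2 / 2) := by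
    have h1 : Real.exp (-‖a‖ ^ 2 / 2) * Real.exp (-‖x‖ ^ 2 / 2) = Real.exp u * Real.exp v := by
      rw [← Real.exp_add, ← Real.exp_add]
      congr 1
      simp only [u, v]
      linarith
    have h2 : Real.exp (-‖a + x‖ ^ 2 / 2) = Real.exp u ^ 2 := by
      rw [← Real.exp_nat_mul]; congr 1; simp only [u]; push_cast; ring
    have h3 : Real.exp (-‖a - x‖ ^ 2 / 2) = Real.exp v ^ 2 := by
      rw [← Real.exp_nat_mul]; congr 1; simp only [v]; push_cast; ring
    rw [h1, h2, h3, ← mul_assoc]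
    exact two_mul_le_add_sq _ _
  have hc : 0 ≤ (2 * Real.pi) ^ (-(n / 2 : ℝ)) := by positivity
  simp only [stdGaussianDensity]
  linarith [mul_le_mul_of_nonneg_left h hc]

lemma lowerIncGamma_sq_div_two {n : ℕ} (hn : 0 < n) {r : ℝ} (hr : 0 ≤ r) :
    lowerIncGamma ((n : ℝ) / 2) (r ^ 2 / 2) =
      2 ^ (1 - (n : ℝ) / 2) * ∫ y in Set.Ioc 0 r, y ^ (n - 1) * Real.exp (-y ^ 2 / 2) := by
  have himg : (fun y : ℝ ↦ y ^ 2 / 2) '' Set.Ioc 0 r = Set.Ioc 0 (r ^ 2 / 2) := by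
    ext w
    constructor
    · rintro ⟨y, ⟨h0, h1⟩, rfl⟩
      exact ⟨by positivity, by dsimp only; gcongr⟩
    · rintro ⟨h0, h1⟩
      refine ⟨√(2 * w), ⟨by positivity, Real.sqrt_le_iff.2 ⟨hr, by linarith⟩⟩, ?_⟩
      dsimp only
      rw [Real.sq_sqrt (by positivity)]
      ring
  rw [lowerIncGamma, ← himg, integral_image_eq_integral_deriv_smul_of_monotoneOn
    (f' := fun y ↦ y) measurableSet_Ioc, ← integral_const_mul]
  · refine setIntegral_congr_fun measurableSet_Ioc fun y ⟨hy, _⟩ ↦ ?_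
    rw [Real.div_rpow (by positivity) (by norm_num), ← Real.rpow_natCast y 2, ← Real.rpow_mul hy.le,
      smul_eq_mul, ← Real.rpow_natCast y (n - 1), Nat.cast_pred hn, div_eq_mul_inv,
      ← Real.rpow_neg (by norm_num), neg_sub, Real.rpow_natCast y 2, neg_div,
      show (n : ℝ) - 1 = 1 + (2 : ℕ) * ((n : ℝ) / 2 - 1) by push_cast; ring, Real.rpow_add hy,
      Real.rpow_one]
    ring
  · intro y _
    simpa using (((hasDerivAt_id y).pow 2).div_const 2).hasDerivWithinAt
  · intro x hx y _ hxy
    dsimp only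
    have := hx.1
    gcongr

section StdGaussian

variable {E : Type*} [NormedAddCommGroup E] [InnerProductSpace ℝ E] [FiniteDimensional ℝ E]
  [MeasurableSpace E] [BorelSpace E]

variable (E) in
lemma integrable_stdGaussianDensity_norm :
    Integrable (fun x : E ↦ stdGaussianDensity (finrank ℝ E) ‖x‖) := by
  have h := (GaussianFourier.integrable_cexp_neg_mul_sq_norm_add (V := E) (b := 1 / 2)
    (by norm_num) 0 0).norm
  simp only [Complex.norm_exp] at h
  refine (h.const_mul ((2 * Real.pi) ^ (-(finrank ℝ E / 2 : ℝ)))).congr (.of_forall fun x ↦ ?_)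
  simp only [stdGaussianDensity]
  congr 2
  simp [← Complex.ofReal_pow]
  ring

lemma stdGaussian_eq_withDensity :
    stdGaussian E =
      volume.withDensity fun x ↦ ENNReal.ofReal (stdGaussianDensity (finrank ℝ E) ‖x‖) := by
  have hfin : IsFiniteMeasure
      (volume.withDensity fun x : E ↦ ENNReal.ofReal (stdGaussianDensity (finrank ℝ E) ‖x‖)) :=
    isFiniteMeasure_withDensity_ofReal (integrable_stdGaussianDensity_norm E).2
  refine Measure.ext_of_charFun (funext fun t ↦ ?_)
  rw [charFun_stdGaussian, charFun_apply,
    integral_withDensity_eq_integral_toReal_smul (by fun_prop) (by simp)]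
  have h := GaussianFourier.integral_cexp_neg_mul_sq_norm_add (V := E) (b := 1 / 2)
    (by norm_num) Complex.I t
  have hpi : ((2 * Real.pi : ℝ) : ℂ) ≠ 0 := by
    exact_mod_cast (by positivity : 2 * Real.pi ≠ 0)
  calc Complex.exp (-‖t‖ ^ 2 / 2)
      = ((2 * Real.pi) ^ (-(finrank ℝ E / 2 : ℝ)) : ℝ) *
          ((Real.pi / (1 / 2)) ^ (finrank ℝ E / 2 : ℂ) *
            Complex.exp (Complex.I ^ 2 * ‖t‖ ^ 2 / (4 * (1 / 2)))) := by
        rw [Complex.ofReal_cpow (by positivity), ← mul_assoc,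
          show (Real.pi / (1 / 2) : ℂ) = ((2 * Real.pi : ℝ) : ℂ) by push_cast; ring]
        push_cast at hpi ⊢
        rw [← Complex.cpow_add _ _ hpi, neg_add_cancel, Complex.cpow_zero, one_mul,
          Complex.I_sq]
        congr 1
        ring
    _ = _ := by
        rw [← h, ← integral_const_mul]
        refine integral_congr_ae (.of_forall fun x ↦ ?_)
        dsimp only
        rw [ENNReal.toReal_ofReal (stdGaussianDensity_pos _ _).le, stdGaussianDensity,
          Complex.real_smul, Complex.ofReal_mul, mul_assoc, Complex.ofReal_exp, ← Complex.exp_add,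
          real_inner_comm]
        congr 2
        push_cast
        ring

/-- Recentring a ball from `0` to `a` costs at most a factor `e^{-‖a‖²/2}` in standard Gaussian
mass. -/
lemma exp_mul_stdGaussian_closedBall_zero_le (a : E) (r : ℝ) :
    ENNReal.ofReal (Real.exp (-‖a‖ ^ 2 / 2)) * stdGaussian E (closedBall 0 r) ≤
      stdGaussian E (closedBall a r) := by
  let ρ : E → ENNReal := fun x ↦ ENNReal.ofReal (stdGaussianDensity (finrank ℝ E) ‖x‖)
  have hρ : Measurable ρ := by fun_prop
  have hadd : ∫⁻ x in closedBall 0 r, ρ (a + x) = ∫⁻ x in closedBall a r, ρ x := by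
    rw [← (measurePreserving_add_left volume a).setLIntegral_comp_preimage
      measurableSet_closedBall hρ]
    simp
  have hsub : ∫⁻ x in closedBall 0 r, ρ (a - x) = ∫⁻ x in closedBall a r, ρ x := by
    rw [← (Measure.measurePreserving_sub_left volume a).setLIntegral_comp_preimage
      measurableSet_closedBall hρ]
    congr 2
    ext x
    simp [dist_eq_norm]
  rw [stdGaussian_eq_withDensity, withDensity_apply _ measurableSet_closedBall,
    withDensity_apply _ measurableSet_closedBall,
    ← ENNReal.mul_le_mul_iff_right two_ne_zero ENNReal.ofNat_ne_top]
  calc 2 * (ENNReal.ofReal (Real.exp (-‖a‖ ^ 2 / 2)) * ∫⁻ x in closedBall 0 r, ρ x)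
      = ∫⁻ x in closedBall 0 r, 2 * (ENNReal.ofReal (Real.exp (-‖a‖ ^ 2 / 2)) * ρ x) := by
        rw [lintegral_const_mul _ (by fun_prop), lintegral_const_mul _ hρ]
    _ ≤ ∫⁻ x in closedBall 0 r, (ρ (a + x) + ρ (a - x)) := by
        refine lintegral_mono fun x ↦ ?_
        simp only [ρ]
        rw [← ENNReal.ofReal_mul (by positivity), ← ENNReal.ofReal_ofNat 2,
          ← ENNReal.ofReal_mul (by positivity),
          ← ENNReal.ofReal_add (stdGaussianDensity_pos _ _).le (stdGaussianDensity_pos _ _).le]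
        exact ENNReal.ofReal_le_ofReal (stdGaussianDensity_parallelogram _ a x)
    _ = 2 * ∫⁻ x in closedBall a r, ρ x := by
        rw [lintegral_add_left (by fun_prop), hadd, hsub, two_mul]

lemma stdGaussian_closedBall_zero [Nontrivial E] {r : ℝ} (hr : 0 ≤ r) :
    stdGaussian E (closedBall 0 r) =
      ENNReal.ofReal (lowerIncGamma ((finrank ℝ E : ℝ) / 2) (r ^ 2 / 2) /
        Real.Gamma ((finrank ℝ E : ℝ) / 2)) := by
  have hn : 0 < finrank ℝ E := finrank_pos
  rw [stdGaussian_eq_withDensity, withDensity_apply _ measurableSet_closedBall,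
    ← ofReal_integral_eq_lintegral_ofReal (integrable_stdGaussianDensity_norm E).integrableOn
      (.of_forall fun x ↦ (stdGaussianDensity_pos _ _).le)]
  congr 1
  have hball : (volume : Measure E).real (ball 0 1) =
      √Real.pi ^ finrank ℝ E / Real.Gamma (finrank ℝ E / 2 + 1) := by
    rw [measureReal_def, InnerProductSpace.volume_ball]
    simp only [ENNReal.ofReal_one, one_pow, one_mul]
    exact ENNReal.toReal_ofReal (by positivity)
  calc ∫ x in closedBall (0 : E) r, stdGaussianDensity (finrank ℝ E) ‖x‖
      = ∫ x : E, (Set.Iic r).indicator (stdGaussianDensity (finrank ℝ E)) ‖x‖ := by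
        rw [← integral_indicator measurableSet_closedBall]
        simp [Set.indicator]
    _ = finrank ℝ E * (√Real.pi ^ finrank ℝ E / Real.Gamma (finrank ℝ E / 2 + 1)) *
          ∫ y in Set.Ioc 0 r, y ^ (finrank ℝ E - 1) * stdGaussianDensity (finrank ℝ E) y := by
        rw [integral_fun_norm_addHaar, hball, nsmul_eq_mul, smul_eq_mul, mul_assoc]
        congr 2
        rw [← Set.Ioi_inter_Iic, ← setIntegral_indicator measurableSet_Iic]
        congr 1 with y
        by_cases h : y ≤ r <;> simp [h]
    _ = _ := by
        rw [lowerIncGamma_sq_div_two hn hr, Real.Gamma_add_one (by positivity)]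
        simp only [stdGaussianDensity, mul_left_comm _ (_ ^ (-_ : ℝ)) _, integral_const_mul]
        have hG : Real.Gamma ((finrank ℝ E : ℝ) / 2) ≠ 0 :=
          (Real.Gamma_pos_of_pos (by positivity)).ne'
        have hpi : √Real.pi ^ finrank ℝ E = Real.pi ^ (finrank ℝ E / 2 : ℝ) := by
          rw [Real.sqrt_eq_rpow, ← Real.rpow_natCast, ← Real.rpow_mul (by positivity)]
          ring_nf
        rw [hpi, Real.mul_rpow (by norm_num) (by positivity), Real.rpow_neg (by positivity),
          Real.rpow_neg (by positivity), Real.rpow_sub (by norm_num), Real.rpow_one]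
        field_simp

end StdGaussian

/-- Gaussian prior mass lower bound via the noncentral chi-squared density: for
`θ ~ N(0, I_d)`, `λ = ‖θ*‖₂²`, and every `r > 0`,
`P(‖θ − θ*‖₂ ≤ r) ≥ (e^{−λ/2}/Γ(d/2)) γ(d/2, r²/2)`. -/
theorem gaussian_ball_mass_noncentral (d : ℕ) (hd : 0 < d)
    (θs : Fin d → ℝ) (r : ℝ) (hr : 0 < r) :
    ENNReal.ofReal
        (Real.exp (-(∑ i, θs i ^ 2) / 2) / Real.Gamma ((d : ℝ) / 2) *
          lowerIncGamma ((d : ℝ) / 2) (r ^ 2 / 2)) ≤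
      (Measure.pi fun _ : Fin d => ProbabilityTheory.gaussianReal 0 1)
        {θ : Fin d → ℝ | Real.sqrt (∑ i, (θ i - θs i) ^ 2) ≤ r} := by
  have : NeZero d := ⟨hd.ne'⟩
  have h := exp_mul_stdGaussian_closedBall_zero_le (WithLp.toLp 2 θs) r
  rw [stdGaussian_closedBall_zero hr.le, ← ENNReal.ofReal_mul (by positivity),
    finrank_euclideanSpace_fin, ← map_pi_eq_stdGaussian,
    Measure.map_apply (by fun_prop) measurableSet_closedBall] at h
  convert h using 2
  · rw [EuclideanSpace.norm_sq_eq]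
    simp only [Real.norm_eq_abs, sq_abs]
    ring
  · ext θ
    simp [EuclideanSpace.dist_eq, Real.dist_eq]
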